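/- arXiv:2502.00362 — 2 statements merged into one kernel-verified Lean document; each statement's English description precedes it below -/
import Mathlib

section
/- Let G = (V, E) be a query graph with n = |V| ≥ 2 vertices and let e₀, …, e_{n−2} be a valid edge sequence of G. Let v₁, v₂ be the two endpoints of e₀ and, for 0 ≤ k ≤ n − 3 wait for 1 ≤ k ≤ n − 2, let v_{k+2} be the unique endpoint of e_k not lying in U_{k−1}. Then the left-deep join tree T with leaf order v₁, …, v_n adheres to G, and its cost satisfies C(T) = Σ_{k=0}^{n−2} κ_k. -/
open Finset

/-- A binary join tree with leaves labeled by relations in `V`. -/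
inductive JoinTree (V : Type*) where
  | leaf (v : V) : JoinTree V
  | node (l r : JoinTree V) : JoinTree V

namespace JoinTree

variable {V : Type*} [DecidableEq V]

/-- The list of leaf labels of a join tree (left to right). -/
def leafList : JoinTree V → List V
  | leaf v => [v]
  | node l r => l.leafList ++ r.leafList

/-- The finite set of leaf labels of a join tree. -/
def leaves : JoinTree V → Finset V
  | leaf v => {v}
  | node l r => l.leaves ∪ r.leaves

/-- The (estimated) cardinality of the join result of a join tree. -/
def card (c : V → ℝ) (f : Sym2 V → ℝ) : JoinTree V → ℝ
  | leaf v => c v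
  | node l r =>
      (∏ i ∈ l.leaves, ∏ j ∈ r.leaves, f s(i, j)) * card c f l * card c f r

/-- The cost of a join tree: sum of the cardinalities of all intermediate results. -/
def cost (c : V → ℝ) (f : Sym2 V → ℝ) : JoinTree V → ℝ
  | leaf _ => 0
  | node l r => card c f (node l r) + cost c f l + cost c f r

/-- A join tree is left-deep if the right child of every internal node is a leaf. -/
def IsLeftDeep : JoinTree V → Prop
  | leaf _ => True
  | node l (leaf _) => IsLeftDeep l
  | node _ (node _ _) => False

/-- A join tree adheres to the query graph `G` if every internal node joins two
subtrees connected by an edge of `G`. -/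
def Adheres (G : SimpleGraph V) : JoinTree V → Prop
  | leaf _ => True
  | node l r =>
      (∃ i ∈ l.leaves, ∃ j ∈ r.leaves, G.Adj i j) ∧ Adheres G l ∧ Adheres G r

/-- The left-deep join tree with leaf labels `v 0, …, v k` from deepest to shallowest. -/
def leftDeep (v : ℕ → V) : ℕ → JoinTree V
  | 0 => leaf (v 0)
  | k + 1 => node (leftDeep v k) (leaf (v (k + 1)))

end JoinTree

section EdgeSeq

variable {V : Type*} [DecidableEq V]

/-- The product of the selectivities over all unordered pairs of distinct vertices of `s`. -/
def pairProd (f : Sym2 V → ℝ) (s : Finset V) : ℝ :=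
  ∏ p ∈ s.sym2 with ¬ p.IsDiag, f p

/-- `∏_{i ∈ s} c(i) · ∏_{{i,j} ⊆ s} f(i,j)`: the cardinality of the join of the relations in `s`. -/
def vertexProd (c : V → ℝ) (f : Sym2 V → ℝ) (s : Finset V) : ℝ :=
  (∏ i ∈ s, c i) * pairProd f s

/-- `U k`: the union of the endpoint sets of the edges `e 0, …, e k`. -/
def endpointSet (e : ℕ → V × V) (k : ℕ) : Finset V :=
  (Finset.range (k + 1)).biUnion fun i => {(e i).1, (e i).2}

/-- A valid edge sequence of length `n - 1` for a query graph `G` on `n` vertices. -/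
def ValidEdgeSeq (G : SimpleGraph V) (n : ℕ) (e : ℕ → V × V) : Prop :=
  (∀ k ≤ n - 2, G.Adj (e k).1 (e k).2) ∧
  (∀ k ≤ n - 2, (endpointSet e k).card = k + 2)

/-- The total cost `Σ_{k=0}^{n-2} κ_k` of an edge sequence. -/
def seqCost (c : V → ℝ) (f : Sym2 V → ℝ) (n : ℕ) (e : ℕ → V × V) : ℝ :=
  ∑ k ∈ Finset.range (n - 1), vertexProd c f (endpointSet e k)

end EdgeSeq

section Helpers

variable {V : Type*} [DecidableEq V]

theorem pairProd_singleton (f : Sym2 V → ℝ) (a : V) : pairProd f {a} = 1 := by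
  simp [pairProd, Finset.filter_singleton]

theorem pairProd_insert (f : Sym2 V → ℝ) {a : V} {s : Finset V} (ha : a ∉ s) :
    pairProd f (insert a s) = (∏ i ∈ s, f s(i, a)) * pairProd f s := by
  have hfilter : (insert a s).sym2.filter (fun p => ¬ p.IsDiag) =
      s.image (fun i => s(i, a)) ∪ s.sym2.filter (fun p => ¬ p.IsDiag) := by
    ext p
    induction p using Sym2.ind with
    | _ x y =>
      simp only [mem_filter, mk_mem_sym2_iff, mem_insert, Sym2.mk_isDiag_iff, mem_union,
        mem_image, Sym2.eq_iff]
      grind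
  have hdisj : Disjoint (s.image fun i => s(i, a))
      (s.sym2.filter fun p => ¬ p.IsDiag) := by
    rw [Finset.disjoint_left]
    simp only [mem_image, mem_filter]
    rintro _ ⟨i, -, rfl⟩ ⟨hmem, -⟩
    exact ha (mk_mem_sym2_iff.1 hmem).2
  unfold pairProd
  rw [hfilter, prod_union hdisj, prod_image]
  intro x _ y _ hxy
  exact Sym2.congr_left.1 hxy

theorem vertexProd_insert (c : V → ℝ) (f : Sym2 V → ℝ) {a : V} {s : Finset V} (ha : a ∉ s) :
    vertexProd c f (insert a s) = (∏ i ∈ s, f s(i, a)) * vertexProd c f s * c a := by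
  rw [vertexProd, vertexProd, pairProd_insert f ha, prod_insert ha]
  ring

namespace JoinTree

theorem leaves_leftDeep_succ (v : ℕ → V) (k : ℕ) :
    (leftDeep v (k + 1)).leaves = insert (v (k + 1)) (leftDeep v k).leaves := by
  rw [leftDeep, leaves, leaves, union_comm, insert_eq]

theorem card_leftDeep (c : V → ℝ) (f : Sym2 V → ℝ) (v : ℕ → V) (k : ℕ)
    (hv : ∀ j < k, v (j + 1) ∉ (leftDeep v j).leaves) :
    (leftDeep v k).card c f = vertexProd c f (leftDeep v k).leaves := by
  induction k with
  | zero => simp [leftDeep, leaves, card, vertexProd, pairProd_singleton]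
  | succ k ih =>
    rw [leaves_leftDeep_succ, vertexProd_insert c f (hv k k.lt_succ_self),
      ← ih fun j hj => hv j (hj.trans k.lt_succ_self)]
    simp [leftDeep, leaves, card]

theorem cost_leftDeep (c : V → ℝ) (f : Sym2 V → ℝ) (v : ℕ → V) (k : ℕ) :
    (leftDeep v k).cost c f = ∑ j ∈ range k, (leftDeep v (j + 1)).card c f := by
  induction k with
  | zero => simp [leftDeep, cost]
  | succ k ih =>
    rw [sum_range_succ, ← ih]
    simp [leftDeep, cost, add_comm]

theorem adheres_leftDeep (G : SimpleGraph V) (v : ℕ → V) (k : ℕ)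
    (hv : ∀ j < k, ∃ i ∈ (leftDeep v j).leaves, G.Adj i (v (j + 1))) :
    (leftDeep v k).Adheres G := by
  induction k with
  | zero => simp [leftDeep, Adheres]
  | succ k ih =>
    simpa [leftDeep, Adheres, leaves] using
      And.intro (hv k k.lt_succ_self) (ih fun j hj => hv j (hj.trans k.lt_succ_self))

end JoinTree

theorem endpointSet_zero (e : ℕ → V × V) : endpointSet e 0 = {(e 0).1, (e 0).2} := by
  simp [endpointSet]

theorem endpointSet_succ (e : ℕ → V × V) (k : ℕ) :
    endpointSet e (k + 1) = {(e (k + 1)).1, (e (k + 1)).2} ∪ endpointSet e k := by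
  rw [endpointSet, range_add_one, biUnion_insert, endpointSet]

theorem endpointSet_succ_eq_insert {e : ℕ → V × V} {k : ℕ} {a : V}
    (hcard : (endpointSet e (k + 1)).card ≤ (endpointSet e k).card + 1)
    (ha : a = (e (k + 1)).1 ∨ a = (e (k + 1)).2) (hanew : a ∉ endpointSet e k) :
    endpointSet e (k + 1) = insert a (endpointSet e k) := by
  refine (eq_of_subset_of_card_le ?_ ?_).symm
  · rw [endpointSet_succ]
    refine insert_subset ?_ subset_union_right
    rcases ha with rfl | rfl <;> simp
  · rwa [card_insert_of_notMem hanew]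

theorem exists_adj_mem_endpointSet {G : SimpleGraph V} {e : ℕ → V × V} {k : ℕ} {a : V}
    (hadj : G.Adj (e (k + 1)).1 (e (k + 1)).2)
    (ha : a = (e (k + 1)).1 ∨ a = (e (k + 1)).2)
    (hins : endpointSet e (k + 1) = insert a (endpointSet e k)) :
    ∃ i ∈ endpointSet e k, G.Adj i a := by
  have hmem : ∀ w, w = (e (k + 1)).1 ∨ w = (e (k + 1)).2 → w ≠ a → w ∈ endpointSet e k := by
    intro w hw hwa
    refine mem_of_mem_insert_of_ne (hins ▸ ?_) hwa
    rw [endpointSet_succ]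
    rcases hw with rfl | rfl <;> simp
  rcases ha with rfl | rfl
  · exact ⟨_, hmem _ (.inr rfl) hadj.ne', hadj.symm⟩
  · exact ⟨_, hmem _ (.inl rfl) hadj.ne, hadj⟩

end Helpers

/-- Given a valid edge sequence `e₀, …, e_{n-2}` of a query graph `G`,
let `v 0, v 1` be the two endpoints of `e₀` and, for `1 ≤ k ≤ n - 2`, let `v (k+1)` be the
unique endpoint of `e k` not lying in `U_{k-1}`.  Then the left-deep join tree with leaf
order `v 0, …, v (n-1)` adheres to `G` and its cost equals `Σ_{k=0}^{n-2} κ_k`. -/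
theorem leftDeep_of_validEdgeSeq_adheres_and_cost
    {V : Type*} [Fintype V] [DecidableEq V] (G : SimpleGraph V)
    (c : V → ℝ) (f : Sym2 V → ℝ)
    (hc : ∀ v, 0 < c v)
    (hf : ∀ p : Sym2 V, ¬ p.IsDiag → 0 < f p ∧ f p ≤ 1)
    (hf1 : ∀ p : Sym2 V, ¬ p.IsDiag → p ∉ G.edgeSet → f p = 1)
    (n : ℕ) (hn : n = Fintype.card V) (hn2 : 2 ≤ n)
    (e : ℕ → V × V) (he : ValidEdgeSeq G n e)
    (v : ℕ → V)
    (hv01 : (v 0 = (e 0).1 ∧ v 1 = (e 0).2) ∨ (v 0 = (e 0).2 ∧ v 1 = (e 0).1))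
    (hvk : ∀ k, 1 ≤ k → k ≤ n - 2 →
      (v (k + 1) = (e k).1 ∨ v (k + 1) = (e k).2) ∧ v (k + 1) ∉ endpointSet e (k - 1)) :
    (JoinTree.leftDeep v (n - 1)).Adheres G ∧
      (JoinTree.leftDeep v (n - 1)).cost c f = seqCost c f n e := by
  obtain ⟨hadj, hcard⟩ := he
  have hins : ∀ k, k + 1 ≤ n - 2 →
      endpointSet e (k + 1) = insert (v (k + 2)) (endpointSet e k) := fun k hk =>
    endpointSet_succ_eq_insert (by rw [hcard _ hk, hcard k (by omega)])
      (hvk (k + 1) (by omega) hk).1 (hvk (k + 1) (by omega) hk).2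
  have hleaves : ∀ k ≤ n - 2, (JoinTree.leftDeep v (k + 1)).leaves = endpointSet e k := by
    intro k hk
    induction k with
    | zero =>
      rw [JoinTree.leaves_leftDeep_succ, endpointSet_zero, JoinTree.leftDeep, JoinTree.leaves]
      rcases hv01 with ⟨h0, h1⟩ | ⟨h0, h1⟩
      · rw [h0, h1, pair_comm]
      · rw [h0, h1]
    | succ k ih => rw [JoinTree.leaves_leftDeep_succ, ih (by omega), hins k hk]
  have hadj01 : G.Adj (v 0) (v 1) := by
    rcases hv01 with ⟨h0, h1⟩ | ⟨h0, h1⟩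
    · rw [h0, h1]
      exact hadj 0 (by omega)
    · rw [h0, h1]
      exact (hadj 0 (by omega)).symm
  have hnew : ∀ j < n - 1, v (j + 1) ∉ (JoinTree.leftDeep v j).leaves := by
    rintro (_ | j) hj
    · simpa [JoinTree.leftDeep, JoinTree.leaves] using hadj01.ne'
    · rw [hleaves j (by omega)]
      exact (hvk (j + 1) (by omega) (by omega)).2
  constructor
  · refine JoinTree.adheres_leftDeep G v _ ?_
    rintro (_ | j) hj
    · exact ⟨v 0, by simp [JoinTree.leftDeep, JoinTree.leaves], hadj01⟩
    · rw [hleaves j (by omega)]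
      exact exists_adj_mem_endpointSet (hadj _ (by omega))
        (hvk (j + 1) (by omega) (by omega)).1 (hins j (by omega))
  · rw [JoinTree.cost_leftDeep, seqCost]
    refine sum_congr rfl fun j hj => ?_
    rw [mem_range] at hj
    rw [JoinTree.card_leftDeep c f v _ fun i hi => hnew i (by omega), hleaves j (by omega)]
end

section
/- Let V be a finite set, c : V → ℝ, and f a symmetric real-valued function on unordered pairs of distinct elements of V. If T and T′ are two join trees over V (binary trees with pairwise distinct leaf labels) having the same set of leaf labels, then |T| = |T′|; that is, the cardinality of a join result depends only on the set of relations joined and not on the order or shape of the join tree. -/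
open Finset

/-- The pair product over a disjoint union splits into the crossing pairs and the two parts. -/
theorem pairProd_union {V : Type*} [DecidableEq V] (f : Sym2 V → ℝ) {s t : Finset V}
    (hst : Disjoint s t) :
    pairProd f (s ∪ t) = (∏ i ∈ s, ∏ j ∈ t, f s(i, j)) * pairProd f s * pairProd f t := by
  have hne : ∀ x ∈ s, ∀ y ∈ t, x ≠ y := fun x hx y hy =>
    Finset.disjoint_iff_ne.mp hst x hx y hy
  have hcross : ∏ i ∈ s, ∏ j ∈ t, f s(i, j) =
      ∏ p ∈ (s ×ˢ t).image (fun q => s(q.1, q.2)), f p := by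
    rw [Finset.prod_image, Finset.prod_product]
    rintro ⟨a, b⟩ hab ⟨a', b'⟩ hab' heq
    simp only [Finset.coe_product, Set.mem_prod, Finset.mem_coe] at hab hab'
    rcases Sym2.eq_iff.mp heq with ⟨h₁, h₂⟩ | ⟨h₁, -⟩
    · exact Prod.ext h₁ h₂
    · exact absurd h₁ (hne a hab.1 b' hab'.2)
  unfold pairProd
  rw [hcross, ← Finset.prod_union, ← Finset.prod_union]
  · refine Finset.prod_congr ?_ fun _ _ => rfl
    ext p
    induction p using Sym2.ind with
    | _ x y =>
      simp only [Finset.mem_filter, Finset.mk_mem_sym2_iff, Finset.mem_union, Finset.mem_image,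
        Finset.mem_product, Prod.exists, Sym2.mk_isDiag_iff, Sym2.eq_iff]
      grind
  all_goals
    rw [Finset.disjoint_left]
    intro p
    induction p using Sym2.ind with
    | _ x y =>
      simp only [Finset.mem_filter, Finset.mk_mem_sym2_iff, Finset.mem_union, Finset.mem_image,
        Finset.mem_product, Prod.exists, Sym2.mk_isDiag_iff, Sym2.eq_iff]
      grind

namespace JoinTree

variable {V : Type*} [DecidableEq V]

theorem mem_leaves_iff (T : JoinTree V) (v : V) : v ∈ T.leaves ↔ v ∈ T.leafList := by
  induction T with
  | leaf w => simp [leaves, leafList]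
  | node l r ihl ihr => simp [leaves, leafList, ihl, ihr]

/-- The cardinality of a join tree with distinct leaves is determined by its leaf set. -/
theorem card_eq_vertexProd (c : V → ℝ) (f : Sym2 V → ℝ) (T : JoinTree V)
    (hT : T.leafList.Nodup) : T.card c f = vertexProd c f T.leaves := by
  induction T with
  | leaf v =>
    simp [card, leaves, vertexProd, pairProd, Finset.filter_singleton]
  | node l r ihl ihr =>
    obtain ⟨hl, hr, hlr⟩ := List.nodup_append'.mp hT
    have hdisj : Disjoint l.leaves r.leaves := Finset.disjoint_left.mpr fun v hvl hvr =>
      hlr ((mem_leaves_iff l v).mp hvl) ((mem_leaves_iff r v).mp hvr)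
    rw [card, leaves, ihl hl, ihr hr, vertexProd, vertexProd, vertexProd,
      Finset.prod_union hdisj, pairProd_union f hdisj]
    ring

end JoinTree

/-- Two join trees (with pairwise distinct leaf labels) having the same
set of leaf labels have the same cardinality: the cardinality of a join result depends
only on the set of relations joined, not on the order or shape of the join tree. -/
theorem joinTree_card_eq_of_leaves_eq
    {V : Type*} [Fintype V] [DecidableEq V]
    (c : V → ℝ) (f : Sym2 V → ℝ)
    (T T' : JoinTree V) (hT : T.leafList.Nodup) (hT' : T'.leafList.Nodup)
    (h : T.leaves = T'.leaves) :
    T.card c f = T'.card c f := by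
  rw [T.card_eq_vertexProd c f hT, T'.card_eq_vertexProd c f hT', h]
end
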